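/- Let n≥3, let ℓ₁,ℓ₂ be linear forms on ℝⁿ with ℓᵢ(x)=aᵢᵀx, let H(x)=(1/2)xᵀAx be a quadratic form (A symmetric), let v₁,…,v_{n−3}∈ℝⁿ be such that a₁,a₂,v₁,…,v_{n−3} are linearly independent, and let α∈ℝ. Define f:ℝⁿ→ℝⁿ by wᵀf(x) = det(w, v₁,…,v_{n−3}, ℓ₂(x)a₁−ℓ₁(x)a₂, Ax) − α H(x)·det(a₁,v₁,…,v_{n−3},a₂,w) for all w∈ℝⁿ. Then: (1) F=ℓ₁/ℓ₂ is a first integral of ẋ=f(x), i.e. ℓ₂(x)·a₁ᵀf(x) − ℓ₁(x)·a₂ᵀf(x) = 0 for all x; (2) each linear form Vᵢ(x)=vᵢᵀx is a first integral, i.e. vᵢᵀf(x)=0 for all x; (3) if α=1, then additionally G=H/ℓ₁ is a first integral, i.e. ℓ₁(x)·(Ax)ᵀf(x) − H(x)·a₁ᵀf(x) = 0 for all x. -/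

import Mathlib

open Matrix

/-- `colDet w v u₁ u₂` is the determinant of the `n×n` matrix (`n = m+3`) whose
columns are `w, v 0, …, v (m−1), u₁, u₂`, in this order. -/
def colDet {m : ℕ} (w : Fin (m + 3) → ℝ) (v : Fin m → Fin (m + 3) → ℝ)
    (u₁ u₂ : Fin (m + 3) → ℝ) : ℝ :=
  Matrix.det (Matrix.of fun i j =>
    (Fin.cons w (Fin.snoc (Fin.snoc v u₁) u₂) : Fin (m + 3) → Fin (m + 3) → ℝ) j i)

section ColDet

variable {m : ℕ} (w : Fin (m + 3) → ℝ) (v : Fin m → Fin (m + 3) → ℝ) (u₁ u₂ : Fin (m + 3) → ℝ)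

theorem colDet_eq_zero_of_eq {i j : Fin (m + 3)} (hij : i ≠ j)
    (h : (Fin.cons w (Fin.snoc (Fin.snoc v u₁) u₂) : Fin (m + 3) → Fin (m + 3) → ℝ) i =
      (Fin.cons w (Fin.snoc (Fin.snoc v u₁) u₂) : Fin (m + 3) → Fin (m + 3) → ℝ) j) :
    colDet w v u₁ u₂ = 0 :=
  Matrix.det_zero_of_column_eq hij fun k => congrFun h k

theorem colDet_self_left : colDet w v w u₂ = 0 :=
  colDet_eq_zero_of_eq _ _ _ _ (i := 0) (j := (Fin.last m).castSucc.succ)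
    (Fin.succ_ne_zero _).symm (by simp)

theorem colDet_self_right : colDet w v u₁ w = 0 :=
  colDet_eq_zero_of_eq _ _ _ _ (i := 0) (j := (Fin.last (m + 1)).succ)
    (Fin.succ_ne_zero _).symm (by simp)

theorem colDet_vector_first (i : Fin m) : colDet (v i) v u₁ u₂ = 0 :=
  colDet_eq_zero_of_eq _ _ _ _ (i := 0) (j := i.castSucc.castSucc.succ)
    (Fin.succ_ne_zero _).symm (by simp)

theorem colDet_vector_last (i : Fin m) : colDet w v u₁ (v i) = 0 :=
  colDet_eq_zero_of_eq _ _ _ _ (i := (Fin.last (m + 1)).succ) (j := i.castSucc.castSucc.succ)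
    (by simp [Fin.ext_iff]; omega) (by simp)

theorem colDet_eq_detRowAlternating_update :
    colDet w v u₁ u₂ = Matrix.detRowAlternating
      (Function.update (Fin.cons w (Fin.snoc (Fin.snoc v 0) u₂) : Fin (m + 3) → Fin (m + 3) → ℝ)
        (Fin.last m).castSucc.succ u₁) := by
  rw [← Fin.cons_update, ← Fin.snoc_update, Fin.update_snoc_last]
  exact (Matrix.det_transpose _).symm

theorem colDet_smul_sub_smul (s t : ℝ) (a b : Fin (m + 3) → ℝ) :
    colDet w v (s • a - t • b) u₂ = s * colDet w v a u₂ - t * colDet w v b u₂ := by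
  simp only [colDet_eq_detRowAlternating_update, AlternatingMap.map_update_sub,
    AlternatingMap.map_update_smul, smul_eq_mul]

theorem colDet_add_left (w' : Fin (m + 3) → ℝ) :
    colDet (w + w') v u₁ u₂ = colDet w v u₁ u₂ + colDet w' v u₁ u₂ := by
  have key (z : Fin (m + 3) → ℝ) : colDet z v u₁ u₂ = Matrix.detRowAlternating
      (Function.update
        (Fin.cons 0 (Fin.snoc (Fin.snoc v u₁) u₂) : Fin (m + 3) → Fin (m + 3) → ℝ) 0 z) := by
    rw [Fin.update_cons_zero]
    exact (Matrix.det_transpose _).symm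
  simp only [key, AlternatingMap.map_update_add]

theorem colDet_swap : colDet u₁ v w u₂ = -colDet w v u₁ u₂ := by
  have h := colDet_self_left (w + u₁) v u₂
  have hr (z : Fin (m + 3) → ℝ) :
      colDet z v (w + u₁) u₂ = colDet z v w u₂ + colDet z v u₁ u₂ := by
    simpa using colDet_smul_sub_smul z v u₂ 1 (-1) w u₁
  rw [colDet_add_left, hr, hr, colDet_self_left, colDet_self_left] at h
  linarith

end ColDet

/-- the vector field `f` defined by
`wᵀf(x) = det(w, v₁,…,v_{n−3}, ℓ₂a₁−ℓ₁a₂, Ax) − αH(x)·det(a₁, v₁,…,v_{n−3}, a₂, w)`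
(with `ℓᵢ(x) = aᵢᵀx`, `H(x) = (1/2)xᵀAx`, `a₁, a₂, v₁,…,v_{n−3}` linearly
independent) admits `F = ℓ₁/ℓ₂` and the linear forms `Vᵢ(x) = vᵢᵀx` as first
integrals, and for `α = 1` additionally `G = H/ℓ₁`. -/
theorem halphen_type_integrals (m : ℕ) (a₁ a₂ : Fin (m + 3) → ℝ)
    (A : Matrix (Fin (m + 3)) (Fin (m + 3)) ℝ) (hA : Aᵀ = A)
    (v : Fin m → Fin (m + 3) → ℝ)
    (hindep : LinearIndependent ℝ
      (Fin.cons a₁ (Fin.cons a₂ v) : Fin (m + 2) → Fin (m + 3) → ℝ))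
    (α : ℝ)
    (ℓ₁ ℓ₂ : (Fin (m + 3) → ℝ) → ℝ)
    (hℓ₁ : ℓ₁ = fun x => a₁ ⬝ᵥ x) (hℓ₂ : ℓ₂ = fun x => a₂ ⬝ᵥ x)
    (H : (Fin (m + 3) → ℝ) → ℝ)
    (hH : H = fun x => (1 / 2 : ℝ) * (x ⬝ᵥ (A *ᵥ x)))
    (f : (Fin (m + 3) → ℝ) → (Fin (m + 3) → ℝ))
    (hf : ∀ (w x : Fin (m + 3) → ℝ), w ⬝ᵥ f x =
      colDet w v (ℓ₂ x • a₁ - ℓ₁ x • a₂) (A *ᵥ x) - α * H x * colDet a₁ v a₂ w) :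
    (∀ x, ℓ₂ x * (a₁ ⬝ᵥ f x) - ℓ₁ x * (a₂ ⬝ᵥ f x) = 0) ∧
    (∀ i x, v i ⬝ᵥ f x = 0) ∧
    (α = 1 → ∀ x, ℓ₁ x * ((A *ᵥ x) ⬝ᵥ f x) - H x * (a₁ ⬝ᵥ f x) = 0) := by
  have hA₁ (x) : a₁ ⬝ᵥ f x = -(ℓ₁ x * colDet a₁ v a₂ (A *ᵥ x)) := by
    rw [hf, colDet_smul_sub_smul, colDet_self_left, colDet_self_right]
    ring
  have hA₂ (x) : a₂ ⬝ᵥ f x = -(ℓ₂ x * colDet a₁ v a₂ (A *ᵥ x)) := by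
    rw [hf, colDet_smul_sub_smul, colDet_self_left, colDet_swap,
      colDet_eq_zero_of_eq a₁ v a₂ a₂ (i := (Fin.last m).castSucc.succ)
        (j := (Fin.last (m + 1)).succ) (by simp [Fin.ext_iff]) (by simp)]
    ring
  refine ⟨fun x => ?_, fun i x => ?_, fun hα x => ?_⟩
  · rw [hA₁, hA₂]
    ring
  · rw [hf, colDet_vector_first, colDet_vector_last]
    ring
  · rw [hA₁, hf, colDet_self_right, hα]
    ring
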